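/- (Derivative lower bound and linear growth from the proof of the convergence theorem.) Fix an index i, and suppose s_i(t) → s_i* and v(t) → v* as t → ∞ with s_i* < v*. Let δ := (v* − s_i*)/3 and c := 1 − (s_i* + δ). Then c > 0 and there exists T ≥ 0 such that for all t ≥ T, s_i'(t) ≥ α·c·δ > 0, and consequently s_i(t) ≥ s_i(T) + α·c·δ·(t − T) for all t ≥ T. -/

import Mathlib

open Filter Topology

theorem barrier_aux (f f' : ℝ → ℝ) (c : ℝ) (hf : ∀ t ≥ (0:ℝ), HasDerivAt f (f' t) t)
    (h0 : f 0 ≤ c) (h : ∀ t ≥ (0:ℝ), c < f t → f' t ≤ 0) : ∀ t ≥ (0:ℝ), f t ≤ c := by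
  intro t ht
  have key : ∀ e > (0:ℝ), f t ≤ c + e * (1 + t) := by
    intro e he
    refine image_le_of_deriv_right_lt_deriv_boundary (f := f) (f' := f') (a := 0) (b := t)
      (B := fun x => c + e * (1 + x)) (B' := fun _ => e) ?_ ?_ ?_ ?_ ?_ ⟨ht, le_refl t⟩
    · intro x hx
      exact (hf x hx.1).continuousAt.continuousWithinAt
    · intro x hx
      exact (hf x hx.1).hasDerivWithinAt
    · linarith
    · intro x
      simpa using (((hasDerivAt_id x).const_add 1).const_mul e).const_add c
    · intro x hx hxe
      have : 0 < e * (1 + x) := mul_pos he (by linarith [hx.1])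
      have := h x hx.1 (by linarith)
      linarith
  by_contra hc
  push Not at hc
  have h1 : 0 < 1 + t := by linarith
  have h2 := key ((f t - c) / (2 * (1 + t))) (div_pos (by linarith) (by linarith))
  have h3 : (f t - c) / (2 * (1 + t)) * (1 + t) = (f t - c) / 2 := by
    field_simp
  linarith

theorem stmt_8
    (n : ℕ) (hn : 1 ≤ n) (α β : ℝ) (hα : 0 < α) (hβ : 0 < β)
    (s : Fin n → ℝ → ℝ) (v : ℝ → ℝ)
    (hs : ∀ i, ∀ t ≥ (0:ℝ),
      HasDerivAt (s i) (α * (1 - s i t) * max (v t - s i t) 0) t)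
    (hv : ∀ t ≥ (0:ℝ),
      HasDerivAt v (β * (1 - v t) * ⨆ i, s i t) t)
    (hs0 : ∀ i, s i 0 ∈ Set.Icc (0:ℝ) 1)
    (hv0 : v 0 ∈ Set.Icc (0:ℝ) 1)
    (i : Fin n) (sStar vStar : ℝ)
    (hsl : Tendsto (s i) atTop (𝓝 sStar))
    (hvl : Tendsto v atTop (𝓝 vStar))
    (hlt : sStar < vStar)
    : 0 < 1 - (sStar + (vStar - sStar) / 3) ∧
      0 < α * (1 - (sStar + (vStar - sStar) / 3)) * ((vStar - sStar) / 3) ∧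
      ∃ T ≥ (0:ℝ), ∀ t ≥ T,
        α * (1 - (sStar + (vStar - sStar) / 3)) * ((vStar - sStar) / 3)
          ≤ deriv (s i) t ∧
        s i T + α * (1 - (sStar + (vStar - sStar) / 3)) * ((vStar - sStar) / 3) * (t - T)
          ≤ s i t := by
  have hsn : ∀ j, ∀ t ≥ (0:ℝ), 0 ≤ s j t := by
    intro j t ht
    have := barrier_aux (fun t => - s j t) (fun t => -(α * (1 - s j t) * max (v t - s j t) 0)) 0
      (fun t ht => (hs j t ht).neg) (by simpa using (hs0 j).1)
      (fun t ht h => by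
        have h1 : 0 ≤ 1 - s j t := by linarith
        have : 0 ≤ α * (1 - s j t) * max (v t - s j t) 0 := by positivity
        linarith) t ht
    simpa using this
  have hv1 : ∀ t ≥ (0:ℝ), v t ≤ 1 := by
    refine barrier_aux v _ 1 hv hv0.2 ?_
    intro t ht h
    have hM : 0 ≤ ⨆ i, s i t := Real.iSup_nonneg (fun j => hsn j t ht)
    exact mul_nonpos_of_nonpos_of_nonneg
      (mul_nonpos_of_nonneg_of_nonpos hβ.le (by linarith)) hM
  have hvS : vStar ≤ 1 := by
    refine le_of_tendsto hvl ?_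
    filter_upwards [eventually_ge_atTop (0:ℝ)] with t ht using hv1 t ht
  obtain ⟨d, hd⟩ : ∃ d, d = (vStar - sStar) / 3 := ⟨_, rfl⟩
  rw [← hd]
  have hd0 : 0 < d := by linarith
  have hc : 0 < 1 - (sStar + d) := by linarith
  refine ⟨hc, by positivity, ?_⟩
  obtain ⟨T, hT⟩ := eventually_atTop.1
    ((hsl.eventually (eventually_lt_nhds (show sStar < sStar + d by linarith))).and
      (hvl.eventually (eventually_gt_nhds (show vStar - d < vStar by linarith))))
  have hder : ∀ t ≥ max T 0, α * (1 - (sStar + d)) * d ≤ deriv (s i) t := by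
    intro t ht
    obtain ⟨h1, h2⟩ := hT t (le_trans (le_max_left _ _) ht)
    rw [(hs i t (le_trans (le_max_right _ _) ht)).deriv]
    have h3 : d ≤ max (v t - s i t) 0 := le_trans (by linarith) (le_max_left _ _)
    have h4 : 1 - (sStar + d) ≤ 1 - s i t := by linarith
    have h5 : 0 ≤ 1 - s i t := by linarith
    gcongr
  refine ⟨max T 0, le_max_right _ _, fun t ht => ⟨hder t ht, ?_⟩⟩
  have hdiff : ∀ x ∈ Set.Ici (max T 0), DifferentiableAt ℝ (s i) x := fun x hx =>
    (hs i x (le_trans (le_max_right _ _) hx)).differentiableAt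
  have := (convex_Ici (max T 0)).mul_sub_le_image_sub_of_le_deriv
    (fun x hx => (hdiff x hx).continuousAt.continuousWithinAt)
    (fun x hx => (hdiff x (interior_subset hx)).differentiableWithinAt)
    (fun x hx => hder x (interior_subset hx)) (max T 0) Set.self_mem_Ici t ht ht
  linarith
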